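/- Let d = (1,1), and let a = (a_1,a_2) with a_1, a_2 ≥ 1. If 0 ≤ k ≤ a_1 a_2 − 1 then the graded piece of S/R(1) in bidegree a and index weighted degree k vanishes; i.e., every monomial in S of bidegree (a_1,a_2) and index weighted degree at most a_1 a_2 − 1 lies in the ideal R(1) = (g_0,...,g_{n_1+n_2}) with g_t = Σ_{i+j=t} x_i y_j. -/

import Mathlib

open MvPolynomial

noncomputable def gElt (K : Type*) [Field K] (n₁ n₂ d₁ d₂ t : ℕ) :
    MvPolynomial (Fin (n₁ + 1) ⊕ Fin (n₂ + 1)) K :=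
  ∑ i : Fin (n₁ + 1), ∑ j : Fin (n₂ + 1),
    if (i : ℕ) + (j : ℕ) = t then X (Sum.inl i) ^ d₁ * X (Sum.inr j) ^ d₂ else 0

noncomputable def RIdeal (K : Type*) [Field K] (n₁ n₂ d₁ d₂ : ℕ) :
    Ideal (MvPolynomial (Fin (n₁ + 1) ⊕ Fin (n₂ + 1)) K) :=
  Ideal.span (Set.range fun t : Fin (n₁ + n₂ + 1) => gElt K n₁ n₂ d₁ d₂ (t : ℕ))

/-- The `x`-degree of a monomial exponent vector. -/
def deg1 (n₁ n₂ : ℕ) (v : (Fin (n₁ + 1) ⊕ Fin (n₂ + 1)) →₀ ℕ) : ℕ :=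
  ∑ i : Fin (n₁ + 1), v (Sum.inl i)

/-- The `y`-degree of a monomial exponent vector. -/
def deg2 (n₁ n₂ : ℕ) (v : (Fin (n₁ + 1) ⊕ Fin (n₂ + 1)) →₀ ℕ) : ℕ :=
  ∑ j : Fin (n₂ + 1), v (Sum.inr j)

/-- The index weighted degree in the `d = (1,1)` case: `x_i` has weight `i`, `y_j` weight `j`. -/
def idxDeg (n₁ n₂ : ℕ) (v : (Fin (n₁ + 1) ⊕ Fin (n₂ + 1)) →₀ ℕ) : ℕ :=
  ∑ i : Fin (n₁ + 1), (i : ℕ) * v (Sum.inl i) + ∑ j : Fin (n₂ + 1), (j : ℕ) * v (Sum.inr j)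

section CoeffProduct

variable {σ Q : Type*} [CommRing Q]

/-- The coefficients of a product of univariate polynomials in separate variables. -/
theorem coeff_prod_aeval_X [Fintype σ] [DecidableEq σ] (F : σ → Polynomial Q) (m : σ →₀ ℕ) :
    coeff m (∏ i, Polynomial.aeval (X i : MvPolynomial σ Q) (F i)) =
      ∏ i, (F i).coeff (m i) := by
  obtain ⟨N, hN⟩ : ∃ N, ∀ i, (F i).natDegree < N ∧ m i < N := by
    refine ⟨∑ i, ((F i).natDegree + m i) + 1, fun i => ?_⟩
    have := Finset.single_le_sum (f := fun i => (F i).natDegree + m i)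
      (fun _ _ => Nat.zero_le _) (Finset.mem_univ i)
    omega
  have hF : ∀ i, Polynomial.aeval (X i : MvPolynomial σ Q) (F i) =
      ∑ k ∈ Finset.range N, monomial (Finsupp.single i k) ((F i).coeff k) := by
    intro i
    rw [Polynomial.aeval_eq_sum_range' (hN i).1]
    refine Finset.sum_congr rfl fun k _ => ?_
    rw [X_pow_eq_monomial, smul_monomial, smul_eq_mul, mul_one]
  have hprod : ∀ p : σ → ℕ, ∏ i, monomial (Finsupp.single i (p i)) ((F i).coeff (p i)) =
      monomial (Finsupp.equivFunOnFinite.symm p) (∏ i, (F i).coeff (p i)) := by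
    intro p
    rw [← Finsupp.univ_sum_single (Finsupp.equivFunOnFinite.symm p), monomial_sum_index]
    simp only [Finsupp.equivFunOnFinite_symm_apply_apply, map_prod, ← Finset.prod_mul_distrib,
      C_mul_monomial, mul_one]
  simp only [hF, Finset.prod_univ_sum, hprod, coeff_sum, coeff_monomial]
  rw [Finset.sum_eq_single (m : σ → ℕ)]
  · simp
  · intro p _ hp
    refine if_neg fun h => hp ?_
    rw [← h]
    rfl
  · intro h
    simp only [Fintype.mem_piFinset, Finset.mem_range] at h
    exact absurd (fun i => (hN i).2) h

variable [DecidableEq σ]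

theorem X_sub_X_dvd_of_rename_eq_zero {a b : σ} {P : MvPolynomial σ Q}
    (h : rename (Function.update id a b) P = 0) : (X a - X b) ∣ P := by
  rw [← Ideal.mem_span_singleton, ← Ideal.Quotient.eq_zero_iff_mem]
  set I : Ideal (MvPolynomial σ Q) := Ideal.span {X a - X b}
  have key : (Ideal.Quotient.mkₐ Q I).comp (rename (Function.update id a b)) =
      Ideal.Quotient.mkₐ Q I := by
    refine algHom_ext fun i => ?_
    simp only [AlgHom.comp_apply, rename_X, Ideal.Quotient.mkₐ_eq_mk]
    by_cases hi : i = a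
    · subst hi
      rw [Function.update_self, eq_comm, Ideal.Quotient.eq]
      exact Ideal.mem_span_singleton_self _
    · rw [Function.update_of_ne hi, id]
  have := DFunLike.congr_fun key P
  rw [AlgHom.comp_apply, h, map_zero] at this
  exact this.symm

theorem eq_zero_of_X_sub_X_mul_eq_zero {a b : σ} (hab : a ≠ b) {P : MvPolynomial σ Q}
    (h : (X a - X b) * P = 0) : P = 0 := by
  let φ (c : MvPolynomial σ Q) : MvPolynomial σ Q →ₐ[Q] MvPolynomial σ Q :=
    aeval (Function.update X a (X a + c))
  have hφ : (φ (-X b)).comp (φ (X b)) = AlgHom.id Q _ := by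
    refine algHom_ext fun i => ?_
    by_cases hi : i = a
    · subst hi
      simp [φ, Function.update_of_ne hab.symm]
    · simp [φ, Function.update_of_ne hi]
  have h' := congrArg (φ (X b)) h
  have hX : φ (X b) (X a - X b) = X a := by
    simp [φ, Function.update_of_ne hab.symm]
  rw [map_mul, hX, map_zero] at h'
  have h0 : φ (X b) P = 0 := by
    ext m
    have := congrArg (coeff (Finsupp.single a 1 + m)) h'
    rwa [coeff_X_mul] at this
  have := DFunLike.congr_fun hφ P
  rw [AlgHom.comp_apply, h0, map_zero] at this
  exact this.symm

theorem eq_zero_of_prod_X_sub_X_mul_eq_zero {ι : Type*} (E : Finset ι) (u w : ι → σ)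
    (huw : ∀ e ∈ E, u e ≠ w e) {P : MvPolynomial σ Q}
    (h : (∏ e ∈ E, (X (u e) - X (w e))) * P = 0) : P = 0 := by
  classical
  induction E using Finset.induction_on with
  | empty => simpa using h
  | insert e E he ih =>
    rw [Finset.prod_insert he, mul_assoc] at h
    exact ih (fun e' he' => huw e' (Finset.mem_insert_of_mem he'))
      (eq_zero_of_X_sub_X_mul_eq_zero (huw e (Finset.mem_insert_self _ _)) h)

end CoeffProduct

section Resultant

variable {A B Q : Type*} [CommRing Q] [DecidableEq A] [DecidableEq B]

theorem prod_X_sub_X_dvd (E : Finset (A × B)) {P : MvPolynomial (A ⊕ B) Q}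
    (h : ∀ e ∈ E, rename (Function.update id (Sum.inl e.1) (Sum.inr e.2)) P = 0) :
    (∏ e ∈ E, (X (Sum.inl e.1) - X (Sum.inr e.2))) ∣ P := by
  induction E using Finset.induction_on with
  | empty => simp
  | insert e E he ih =>
    obtain ⟨H, rfl⟩ := ih fun e' he' => h e' (Finset.mem_insert_of_mem he')
    rw [Finset.prod_insert he, mul_comm (X _ - X _)]
    refine mul_dvd_mul_left _ (X_sub_X_dvd_of_rename_eq_zero ?_)
    have h0 := h e (Finset.mem_insert_self _ _)
    simp only [map_mul, map_prod, map_sub, rename_X] at h0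
    refine eq_zero_of_prod_X_sub_X_mul_eq_zero E _ _ (fun e' he' => ?_) h0
    rw [Function.update_of_ne Sum.inr_ne_inl, id]
    by_cases h1 : e'.1 = e.1
    · rw [h1, Function.update_self]
      intro h2
      exact he (Prod.ext h1 (Sum.inr_injective h2).symm ▸ he')
    · rw [Function.update_of_ne (fun h2 => h1 (Sum.inl_injective h2)), id]
      exact Sum.inl_ne_inr

/-- If `f * g = 0`, then products of `card A` coefficients of `f` and `card B` coefficients of `g`
vanish as soon as the sum of the indices is less than `card A * card B`. -/
theorem prod_coeff_mul_prod_coeff_eq_zero [Fintype A] [Fintype B] {f g : Polynomial Q}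
    (hfg : f * g = 0) (m : A → ℕ) (n : B → ℕ)
    (hlt : ∑ a, m a + ∑ b, n b < Fintype.card A * Fintype.card B) :
    (∏ a, f.coeff (m a)) * ∏ b, g.coeff (n b) = 0 := by
  let F : A ⊕ B → Polynomial Q := Sum.elim (fun _ => f) (fun _ => g)
  let P : MvPolynomial (A ⊕ B) Q := ∏ i, Polynomial.aeval (X i) (F i)
  let M : A ⊕ B →₀ ℕ := Finsupp.equivFunOnFinite.symm (Sum.elim m n)
  have hP : coeff M P = (∏ a, f.coeff (m a)) * ∏ b, g.coeff (n b) := by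
    rw [coeff_prod_aeval_X, Fintype.prod_sum_type]
    rfl
  rw [← hP]
  obtain ⟨H, hH⟩ : (∏ e : A × B, (X (Sum.inl e.1) - X (Sum.inr e.2))) ∣ P := by
    refine prod_X_sub_X_dvd _ fun e _ => ?_
    have hdvd : Polynomial.aeval (X (Sum.inl e.1)) f * Polynomial.aeval (X (Sum.inr e.2)) g ∣
        P := by
      simp only [P, Fintype.prod_sum_type]
      exact mul_dvd_mul (Finset.dvd_prod_of_mem (fun a : A => Polynomial.aeval
          (X (Sum.inl a) : MvPolynomial (A ⊕ B) Q) f) (Finset.mem_univ e.1))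
        (Finset.dvd_prod_of_mem (fun b : B => Polynomial.aeval
          (X (Sum.inr b) : MvPolynomial (A ⊕ B) Q) g) (Finset.mem_univ e.2))
    obtain ⟨T, hT⟩ := hdvd
    rw [hT, map_mul, map_mul, ← Polynomial.aeval_algHom_apply, ← Polynomial.aeval_algHom_apply,
      rename_X, rename_X, Function.update_self, Function.update_of_ne Sum.inr_ne_inl, id,
      ← map_mul, hfg, map_zero, zero_mul]
  have hhom : (∏ e : A × B, (X (Sum.inl e.1) - X (Sum.inr e.2) :
      MvPolynomial (A ⊕ B) Q)).IsHomogeneous (Fintype.card A * Fintype.card B) := by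
    have := IsHomogeneous.prod Finset.univ
      (fun e : A × B => (X (Sum.inl e.1) - X (Sum.inr e.2) : MvPolynomial (A ⊕ B) Q))
      (fun _ => 1) fun e _ => (isHomogeneous_X _ _).sub (isHomogeneous_X _ _)
    simpa using this
  rw [hH, coeff_mul]
  refine Finset.sum_eq_zero fun x hx => ?_
  rw [hhom.coeff_eq_zero, zero_mul]
  have hdeg : M.degree = ∑ a, m a + ∑ b, n b := by
    rw [Finsupp.degree_eq_sum, Fintype.sum_sum_type]
    rfl
  rw [← Finset.HasAntidiagonal.mem_antidiagonal.mp hx, map_add] at hdeg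
  omega

end Resultant

theorem gElt_mem_RIdeal (K : Type*) [Field K] (n₁ n₂ d₁ d₂ t : ℕ) :
    gElt K n₁ n₂ d₁ d₂ t ∈ RIdeal K n₁ n₂ d₁ d₂ := by
  by_cases ht : t < n₁ + n₂ + 1
  · exact Ideal.subset_span ⟨⟨t, ht⟩, rfl⟩
  · have : gElt K n₁ n₂ d₁ d₂ t = 0 :=
      Finset.sum_eq_zero fun i _ => Finset.sum_eq_zero fun j _ => if_neg (by omega)
    rw [this]
    exact zero_mem _

/-- For `d = (1,1)`: every monomial of bidegree `(a₁, a₂)` with `a₁, a₂ ≥ 1` and index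
weighted degree `k ≤ a₁·a₂ − 1` lies in `R(1)`. -/
theorem stmt_12 (K : Type*) [Field K] (n₁ n₂ : ℕ)
    (hn₁ : 1 ≤ n₁) (hn₂ : 1 ≤ n₂) (a₁ a₂ k : ℕ) (ha₁ : 1 ≤ a₁) (ha₂ : 1 ≤ a₂)
    (hk : k ≤ a₁ * a₂ - 1)
    (v : (Fin (n₁ + 1) ⊕ Fin (n₂ + 1)) →₀ ℕ)
    (h1 : deg1 n₁ n₂ v = a₁) (h2 : deg2 n₁ n₂ v = a₂) (hidx : idxDeg n₁ n₂ v = k) :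
    monomial v (1 : K) ∈ RIdeal K n₁ n₂ 1 1 := by
  set π := Ideal.Quotient.mk (RIdeal K n₁ n₂ 1 1) with hπ
  let f : Polynomial (_ ⧸ RIdeal K n₁ n₂ 1 1) :=
    ∑ i : Fin (n₁ + 1), Polynomial.monomial (i : ℕ) (π (X (Sum.inl i)))
  let g : Polynomial (_ ⧸ RIdeal K n₁ n₂ 1 1) :=
    ∑ j : Fin (n₂ + 1), Polynomial.monomial (j : ℕ) (π (X (Sum.inr j)))
  have hf : ∀ i : Fin (n₁ + 1), f.coeff i = π (X (Sum.inl i)) := fun i => by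
    simp [f, Polynomial.finsetSum_coeff, Polynomial.coeff_monomial, Fin.val_inj]
  have hg : ∀ j : Fin (n₂ + 1), g.coeff j = π (X (Sum.inr j)) := fun j => by
    simp [g, Polynomial.finsetSum_coeff, Polynomial.coeff_monomial, Fin.val_inj]
  have hfg : f * g = 0 := by
    ext t
    have ht : π (gElt K n₁ n₂ 1 1 t) = 0 :=
      Ideal.Quotient.eq_zero_iff_mem.mpr (gElt_mem_RIdeal K n₁ n₂ 1 1 t)
    rw [Polynomial.coeff_zero, ← ht]
    simp only [f, g, Finset.sum_mul_sum, Polynomial.monomial_mul_monomial,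
      Polynomial.finsetSum_coeff, Polynomial.coeff_monomial, gElt, map_sum, pow_one, apply_ite π,
      map_mul, map_zero]
  have key := prod_coeff_mul_prod_coeff_eq_zero hfg
    (fun a : (Σ i : Fin (n₁ + 1), Fin (v (Sum.inl i))) => (a.1 : ℕ))
    (fun b : (Σ j : Fin (n₂ + 1), Fin (v (Sum.inr j))) => (b.1 : ℕ)) (by
      have hpos := Nat.mul_pos ha₁ ha₂
      simp only [deg1, deg2, idxDeg] at h1 h2 hidx
      simp only [Fintype.sum_sigma, Finset.sum_const, Finset.card_univ, Fintype.card_fin,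
        Fintype.card_sigma, h1, h2, smul_eq_mul, mul_comm (v _)]
      omega)
  rw [← Ideal.Quotient.eq_zero_iff_mem, ← hπ, monomial_eq, C_1, one_mul,
    Finsupp.prod_fintype _ _ (fun _ => pow_zero _), Fintype.prod_sum_type]
  simpa [Fintype.prod_sigma, hf, hg] using key
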